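/- For all admissible parameters (p, x, σ, β) with z = p − Σ_{i=1}^{n−1} x_i²/σ_i > 0, the scalar curvature τ of the inner product S(p, x, σ, β) on 𝔠𝔥(n) is strictly negative; i.e., every left invariant Riemannian metric on the Lie group CH(n) has constant negative scalar curvature. -/

import Mathlib

noncomputable section

open Matrix BigOperators Finset

namespace CHn

/-- Structure constants of the Lie algebra 𝔠𝔥(n) in the ordered basis
`(X, Y_1, …, Y_{n-1}, Z_1, …, Z_{n-1}, W)`:
index `0 ↦ X`, indices `1,…,n-1 ↦ Y_1,…,Y_{n-1}`,
indices `n,…,2n-2 ↦ Z_1,…,Z_{n-1}`, index `2n-1 ↦ W`.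
The nonzero brackets are `[X,Y_i] = (1/2)Y_i`, `[X,Z_i] = (1/2)Z_i`,
`[X,W] = W`, `[Z_j,Y_i] = δ_{ij} W`. -/
def structC (n : ℕ) (i j k : Fin (2 * n)) : ℝ :=
  (if i.val = 0 ∧ j = k ∧ 1 ≤ j.val ∧ j.val ≤ 2 * n - 2 then (1 : ℝ) / 2 else 0)
  - (if j.val = 0 ∧ i = k ∧ 1 ≤ i.val ∧ i.val ≤ 2 * n - 2 then (1 : ℝ) / 2 else 0)
  + (if i.val = 0 ∧ j.val = 2 * n - 1 ∧ k.val = 2 * n - 1 then (1 : ℝ) else 0)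
  - (if j.val = 0 ∧ i.val = 2 * n - 1 ∧ k.val = 2 * n - 1 then (1 : ℝ) else 0)
  + (if n ≤ i.val ∧ i.val ≤ 2 * n - 2 ∧ i.val = j.val + (n - 1) ∧ k.val = 2 * n - 1
      then (1 : ℝ) else 0)
  - (if n ≤ j.val ∧ j.val ≤ 2 * n - 2 ∧ j.val = i.val + (n - 1) ∧ k.val = 2 * n - 1
      then (1 : ℝ) else 0)

/-- The Lie bracket of `𝔠𝔥(n)`, as a bilinear operation on coordinate vectors. -/
def bracket (n : ℕ) (u v : Fin (2 * n) → ℝ) : Fin (2 * n) → ℝ :=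
  fun k => ∑ i, ∑ j, u i * v j * structC n i j k

/-- `F` is the matrix (in the ordered basis) of a Lie algebra automorphism of `𝔠𝔥(n)`. -/
def IsAut (n : ℕ) (F : Matrix (Fin (2 * n)) (Fin (2 * n)) ℝ) : Prop :=
  IsUnit F ∧ ∀ u v, F.mulVec (bracket n u v) = bracket n (F.mulVec u) (F.mulVec v)

/-- The normal form `S(p, x, σ, β)`: the block matrix
`[[p, xᵀ, 0, 0], [x, σ, 0, 0], [0, 0, σ, 0], [0, 0, 0, β]]`
with blocks of sizes `1, n-1, n-1, 1`. -/
def Sform (n : ℕ) (p : ℝ) (x σ : Fin (n - 1) → ℝ) (β : ℝ) :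
    Matrix (Fin (2 * n)) (Fin (2 * n)) ℝ := fun i j =>
  if i.val = 0 ∧ j.val = 0 then p
  else if h : i.val = 0 ∧ 1 ≤ j.val ∧ j.val ≤ n - 1 then x ⟨j.val - 1, by omega⟩
  else if h : j.val = 0 ∧ 1 ≤ i.val ∧ i.val ≤ n - 1 then x ⟨i.val - 1, by omega⟩
  else if h : i = j ∧ 1 ≤ i.val ∧ i.val ≤ n - 1 then σ ⟨i.val - 1, by omega⟩
  else if h : i = j ∧ n ≤ i.val ∧ i.val ≤ 2 * n - 2 then σ ⟨i.val - n, by omega⟩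
  else if i = j ∧ i.val = 2 * n - 1 then β
  else 0

/-- Admissibility of the parameters `(p, x, σ, β)`:
`p, β > 0`, all `x_i ≥ 0`, `σ_1 ≥ … ≥ σ_{n-2} ≥ 1` and the convention `σ_{n-1} = 1`. -/
def Admissible (n : ℕ) (p : ℝ) (x σ : Fin (n - 1) → ℝ) (β : ℝ) : Prop :=
  0 < p ∧ 0 < β ∧ (∀ i, 0 ≤ x i) ∧ Antitone σ ∧ (∀ i, 1 ≤ σ i) ∧
    ∀ _h : 1 ≤ n - 1, σ ⟨n - 2, by omega⟩ = 1

/-- `z = p - Σ_i x_i² / σ_i`. -/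
def zval (n : ℕ) (p : ℝ) (x σ : Fin (n - 1) → ℝ) : ℝ :=
  p - ∑ i, (x i) ^ 2 / σ i

/-- The inner product on `𝔠𝔥(n)` determined by a matrix `S`. -/
def ip (n : ℕ) (S : Matrix (Fin (2 * n)) (Fin (2 * n)) ℝ) (u v : Fin (2 * n) → ℝ) : ℝ :=
  u ⬝ᵥ S.mulVec v

/-- The coordinates (w.r.t. the standard basis) of the Koszul form
`K(u,v)(T) = ⟨[u,v],T⟩ - ⟨[v,T],u⟩ + ⟨[T,u],v⟩`. -/
def koszul (n : ℕ) (S : Matrix (Fin (2 * n)) (Fin (2 * n)) ℝ)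
    (u v : Fin (2 * n) → ℝ) : Fin (2 * n) → ℝ := fun t =>
  ip n S (bracket n u v) (Pi.single t 1) - ip n S (bracket n v (Pi.single t 1)) u
    + ip n S (bracket n (Pi.single t 1) u) v

/-- The Levi-Civita product `∇_u v` of the inner product `S`,
i.e. the unique solution of the Koszul formula `2⟨∇_u v, T⟩ = K(u,v)(T)`
(for invertible symmetric `S`). -/
def nabla (n : ℕ) (S : Matrix (Fin (2 * n)) (Fin (2 * n)) ℝ)
    (u v : Fin (2 * n) → ℝ) : Fin (2 * n) → ℝ :=
  (2 : ℝ)⁻¹ • (S⁻¹).mulVec (koszul n S u v)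

/-- The curvature operator `R(u,v)w = ∇_u∇_v w - ∇_v∇_u w - ∇_{[u,v]} w`. -/
def curv (n : ℕ) (S : Matrix (Fin (2 * n)) (Fin (2 * n)) ℝ)
    (u v w : Fin (2 * n) → ℝ) : Fin (2 * n) → ℝ :=
  nabla n S u (nabla n S v w) - nabla n S v (nabla n S u w) - nabla n S (bracket n u v) w

/-- The Ricci form `Ric(u,v) = tr (T ↦ R(T,u)v)`. -/
def ricci (n : ℕ) (S : Matrix (Fin (2 * n)) (Fin (2 * n)) ℝ)
    (u v : Fin (2 * n) → ℝ) : ℝ :=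
  ∑ t, curv n S (Pi.single t 1) u v t

/-- The scalar curvature `τ = Σ_{i,j} g^{ij} Ric(e_i, e_j)`. -/
def scalarCurv (n : ℕ) (S : Matrix (Fin (2 * n)) (Fin (2 * n)) ℝ) : ℝ :=
  ∑ i, ∑ j, (S⁻¹) i j * ricci n S (Pi.single i 1) (Pi.single j 1)

/-- The wedge endomorphism `(u∧v)(w) = ⟨v,w⟩u - ⟨u,w⟩v`. -/
def wedge (n : ℕ) (S : Matrix (Fin (2 * n)) (Fin (2 * n)) ℝ)
    (u v : Fin (2 * n) → ℝ) : (Fin (2 * n) → ℝ) → (Fin (2 * n) → ℝ) :=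
  fun w => ip n S v w • u - ip n S u w • v

/-- The standard symplectic matrix `J_m = [[0, I_m], [-I_m, 0]]`. -/
def Jmat (m : ℕ) : Matrix (Fin (2 * m)) (Fin (2 * m)) ℝ := fun i j =>
  if j.val = i.val + m then 1 else if i.val = j.val + m then -1 else 0

/-- The block matrix `[[1, 0, 0], [u, M, 0], [a, vᵀ, λ]]`
with blocks of sizes `1, 2n-2, 1`. -/
def blockF (n : ℕ) (M : Matrix (Fin (2 * (n - 1))) (Fin (2 * (n - 1))) ℝ)
    (u v : Fin (2 * (n - 1)) → ℝ) (a lam : ℝ) :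
    Matrix (Fin (2 * n)) (Fin (2 * n)) ℝ := fun i j =>
  if i.val = 0 then (if j.val = 0 then 1 else 0)
  else if h : 1 ≤ i.val ∧ i.val ≤ 2 * n - 2 then
    (if j.val = 0 then u ⟨i.val - 1, by omega⟩
     else if h2 : 1 ≤ j.val ∧ j.val ≤ 2 * n - 2 then
       M ⟨i.val - 1, by omega⟩ ⟨j.val - 1, by omega⟩
     else 0)
  else
    (if j.val = 0 then a
     else if h2 : 1 ≤ j.val ∧ j.val ≤ 2 * n - 2 then v ⟨j.val - 1, by omega⟩
     else lam)

/-- The metric is Einstein: the Ricci form is proportional to the inner product. -/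
def IsEinstein (n : ℕ) (S : Matrix (Fin (2 * n)) (Fin (2 * n)) ℝ) : Prop :=
  ∃ c : ℝ, ∀ u v, ricci n S u v = c * ip n S u v

end CHn

namespace CHn

abbrev V (n : ℕ) := Fin (2 * n) → ℝ

/-- The bracket as a bilinear map. -/
def brL (n : ℕ) : V n →ₗ[ℝ] V n →ₗ[ℝ] V n :=
  LinearMap.mk₂ ℝ (bracket n)
    (by intro a b c; ext k; simp [bracket, add_mul, Finset.sum_add_distrib])
    (by intro r a b; ext k; simp [bracket, Finset.mul_sum, mul_assoc])
    (by intro a b c; ext k; simp [bracket, mul_add, add_mul, Finset.sum_add_distrib])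
    (by intro r a b; ext k; simp [bracket, Finset.mul_sum, mul_assoc, mul_left_comm])

lemma brL_apply (n : ℕ) (u v : V n) : brL n u v = bracket n u v := rfl

/-- The inner product as a bilinear form. -/
def ipL (n : ℕ) (S : Matrix (Fin (2 * n)) (Fin (2 * n)) ℝ) : V n →ₗ[ℝ] V n →ₗ[ℝ] ℝ :=
  LinearMap.mk₂ ℝ (ip n S)
    (by intro a b c; simp [ip, add_dotProduct])
    (by intro r a b; simp [ip])
    (by intro a b c; simp [ip, Matrix.mulVec_add, dotProduct_add])
    (by intro r a b; simp [ip, Matrix.mulVec_smul])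

lemma ipL_apply (n : ℕ) (S : Matrix (Fin (2 * n)) (Fin (2 * n)) ℝ) (u v : V n) :
    ipL n S u v = ip n S u v := rfl

lemma koszul_eq (n : ℕ) (S : Matrix (Fin (2 * n)) (Fin (2 * n)) ℝ) (u v : V n) (t) :
    koszul n S u v t = ipL n S (brL n u v) (Pi.single t 1)
      - ipL n S (brL n v (Pi.single t 1)) u + ipL n S (brL n (Pi.single t 1) u) v := rfl

/-- The Levi-Civita product as a bilinear map. -/
def nabL (n : ℕ) (S : Matrix (Fin (2 * n)) (Fin (2 * n)) ℝ) : V n →ₗ[ℝ] V n →ₗ[ℝ] V n :=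
  LinearMap.mk₂ ℝ (nabla n S)
    (by
      intro a b c
      have : koszul n S (a + b) c = koszul n S a c + koszul n S b c := by
        ext t; simp only [koszul_eq, map_add, LinearMap.add_apply, Pi.add_apply]; ring
      simp [nabla, this, Matrix.mulVec_add])
    (by
      intro r a c
      have : koszul n S (r • a) c = r • koszul n S a c := by
        ext t
        simp only [koszul_eq, map_smul, LinearMap.smul_apply, Pi.smul_apply, smul_eq_mul]; ring
      rw [nabla, this, Matrix.mulVec_smul, smul_comm, nabla])
    (by
      intro a b c
      have : koszul n S a (b + c) = koszul n S a b + koszul n S a c := by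
        ext t; simp only [koszul_eq, map_add, LinearMap.add_apply, Pi.add_apply]; ring
      simp [nabla, this, Matrix.mulVec_add])
    (by
      intro r a c
      have : koszul n S a (r • c) = r • koszul n S a c := by
        ext t
        simp only [koszul_eq, map_smul, LinearMap.smul_apply, Pi.smul_apply, smul_eq_mul]; ring
      rw [nabla, this, Matrix.mulVec_smul, smul_comm, nabla])

lemma nabL_apply (n : ℕ) (S : Matrix (Fin (2 * n)) (Fin (2 * n)) ℝ) (u v : V n) :
    nabL n S u v = nabla n S u v := rfl

lemma vec_eq_sum (n : ℕ) (u : V n) : u = ∑ t, u t • (Pi.single t 1 : V n) := by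
  ext k; simp [Finset.sum_apply, Pi.single_apply]

lemma koszul_formula (n : ℕ) (S : Matrix (Fin (2 * n)) (Fin (2 * n)) ℝ) (hT : Sᵀ = S)
    (hS : IsUnit S.det) (u v w : V n) :
    ipL n S (nabL n S u v) w = 2⁻¹ * (ipL n S (brL n u v) w - ipL n S (brL n v w) u
      + ipL n S (brL n w u) v) := by
  have h1 : ipL n S (nabL n S u v) w = 2⁻¹ * ∑ t, w t * koszul n S u v t := by
    rw [ipL_apply, nabL_apply, ip, nabla, Matrix.dotProduct_mulVec, Matrix.smul_vecMul,
      ← Matrix.mulVec_transpose, hT, Matrix.mulVec_mulVec, Matrix.mul_nonsing_inv _ hS,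
      Matrix.one_mulVec, smul_dotProduct, dotProduct, smul_eq_mul]
    simp [mul_comm]
  rw [h1]
  congr 1
  conv_rhs => rw [vec_eq_sum n w]
  simp only [koszul_eq, map_sum, map_smul, LinearMap.sum_apply, LinearMap.smul_apply, smul_eq_mul,
    mul_add, mul_sub, Finset.sum_add_distrib, Finset.sum_sub_distrib]

lemma structC_antisymm (n : ℕ) (i j k : Fin (2 * n)) : structC n i j k = - structC n j i k := by
  unfold structC; ring

lemma brL_antisymm (n : ℕ) (u v : V n) : brL n u v = - brL n v u := by
  ext k
  simp only [brL_apply, bracket, Pi.neg_apply, ← Finset.sum_neg_distrib]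
  rw [Finset.sum_comm]
  refine Finset.sum_congr rfl fun i _ => Finset.sum_congr rfl fun j _ => ?_
  rw [structC_antisymm]; ring

/-- An orthonormal frame. -/
structure IsFrame (n : ℕ) (S : Matrix (Fin (2 * n)) (Fin (2 * n)) ℝ)
    (f : Fin (2 * n) → V n) : Prop where
  expand : ∀ v, v = ∑ a, ipL n S v (f a) • f a
  inv : ∀ i j, S⁻¹ i j = ∑ a, f a i * f a j

lemma exists_frame (n : ℕ) (S : Matrix (Fin (2 * n)) (Fin (2 * n)) ℝ) (hS : S.PosDef) :
    ∃ f, IsFrame n S f := by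
  open scoped MatrixOrder in
  obtain ⟨B, hB⟩ := CStarAlgebra.nonneg_iff_eq_star_mul_self.mp hS.posSemidef.nonneg
  have hB' : S = Bᵀ * B := by simpa [Matrix.star_eq_conjTranspose] using hB
  have hu : IsUnit S.det := (Matrix.isUnit_iff_isUnit_det _).1 hS.isUnit
  have hinv : S⁻¹ = B⁻¹ * (B⁻¹)ᵀ := by
    rw [hB', Matrix.mul_inv_rev, Matrix.transpose_nonsing_inv]
  have hT : Sᵀ = S := by rw [hB']; simp
  refine ⟨fun a i => B⁻¹ i a, ?_, ?_⟩
  · intro v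
    have : v = S⁻¹ *ᵥ (S *ᵥ v) := by
      rw [Matrix.mulVec_mulVec, Matrix.nonsing_inv_mul _ hu, Matrix.one_mulVec]
    conv_lhs => rw [this, hinv, ← Matrix.mulVec_mulVec]
    ext i
    simp only [Finset.sum_apply, Pi.smul_apply, smul_eq_mul, ipL_apply, ip]
    rw [Matrix.mulVec, dotProduct]
    refine Finset.sum_congr rfl fun a _ => ?_
    rw [mul_comm]
    congr 1
    rw [Matrix.dotProduct_mulVec, ← Matrix.mulVec_transpose, hT, Matrix.mulVec, dotProduct_comm]
    rfl
  · intro i j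
    rw [hinv, Matrix.mul_apply]; rfl

lemma trace_frame (n : ℕ) (S f) (hf : IsFrame n S f) (L : V n →ₗ[ℝ] V n) :
    ∑ t, L (Pi.single t 1) t = ∑ a, ipL n S (L (f a)) (f a) := by
  have h1 : ∀ t, L (Pi.single t 1) t = ∑ a, ipL n S (L (Pi.single t 1)) (f a) * f a t := by
    intro t
    have := congrFun (hf.expand (L (Pi.single t 1))) t
    simpa using this
  simp only [h1]
  rw [Finset.sum_comm]
  refine Finset.sum_congr rfl fun a _ => ?_
  conv_rhs => rw [vec_eq_sum n (f a)]
  conv_rhs => enter [2]; rw [← vec_eq_sum n (f a)]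
  simp [map_sum, LinearMap.sum_apply, mul_comm]

lemma contract_frame (n : ℕ) (S f) (hf : IsFrame n S f) (Q : V n →ₗ[ℝ] V n →ₗ[ℝ] ℝ) :
    ∑ i, ∑ j, S⁻¹ i j * Q (Pi.single i 1) (Pi.single j 1) = ∑ a, Q (f a) (f a) := by
  have : ∀ a, Q (f a) (f a) = ∑ i, ∑ j, f a i * f a j * Q (Pi.single i 1) (Pi.single j 1) := by
    intro a
    conv_lhs => rw [vec_eq_sum n (f a)]
    simp only [map_sum, map_smul, LinearMap.sum_apply, LinearMap.smul_apply, smul_eq_mul,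
      Finset.mul_sum, mul_assoc]
    rw [Finset.sum_comm]
    refine Finset.sum_congr rfl fun i _ => Finset.sum_congr rfl fun j _ => ?_
    ring
  simp only [this, hf.inv, Finset.sum_mul]
  rw [Finset.sum_comm' (t' := Finset.univ) (s' := fun _ => Finset.univ) (by simp)]
  rw [Finset.sum_comm]
  conv_rhs => rw [Finset.sum_comm]
  refine Finset.sum_congr rfl fun i _ => ?_
  rw [Finset.sum_comm]

/-- The curvature, linear in its first argument. -/
lemma curv_eq (n : ℕ) (S : Matrix (Fin (2 * n)) (Fin (2 * n)) ℝ) (u v w : V n) :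
    curv n S u v w = nabL n S u (nabL n S v w) - nabL n S v (nabL n S u w)
      - nabL n S (brL n u v) w := rfl

def curvL (n : ℕ) (S : Matrix (Fin (2 * n)) (Fin (2 * n)) ℝ) (v w : V n) : V n →ₗ[ℝ] V n where
  toFun u := curv n S u v w
  map_add' a b := by simp only [curv_eq, map_add, LinearMap.add_apply]; abel
  map_smul' r a := by
    simp only [curv_eq, map_smul, LinearMap.smul_apply, smul_sub, RingHom.id_apply]

lemma ricci_frame (n : ℕ) (S f) (hf : IsFrame n S f) (u v : V n) :
    ricci n S u v = ∑ t, ipL n S (curv n S (f t) u v) (f t) :=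
  trace_frame n S f hf (curvL n S u v)

def ricL (n : ℕ) (S : Matrix (Fin (2 * n)) (Fin (2 * n)) ℝ) : V n →ₗ[ℝ] V n →ₗ[ℝ] ℝ :=
  LinearMap.mk₂ ℝ (ricci n S)
    (by
      intro a b c
      simp only [ricci, ← Finset.sum_add_distrib, curv_eq, map_add, LinearMap.add_apply,
        Pi.sub_apply, Pi.add_apply]
      exact Finset.sum_congr rfl fun t _ => by ring)
    (by
      intro r b c
      simp only [ricci, smul_eq_mul, Finset.mul_sum, curv_eq, map_smul, LinearMap.smul_apply,
        Pi.sub_apply, Pi.smul_apply]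
      exact Finset.sum_congr rfl fun t _ => by ring)
    (by
      intro a b c
      simp only [ricci, ← Finset.sum_add_distrib, curv_eq, map_add, LinearMap.add_apply,
        Pi.sub_apply, Pi.add_apply]
      exact Finset.sum_congr rfl fun t _ => by ring)
    (by
      intro r b c
      simp only [ricci, smul_eq_mul, Finset.mul_sum, curv_eq, map_smul, LinearMap.smul_apply,
        Pi.sub_apply, Pi.smul_apply]
      exact Finset.sum_congr rfl fun t _ => by ring)

lemma scalar_frame (n : ℕ) (S f) (hf : IsFrame n S f) :
    scalarCurv n S = ∑ a, ∑ t, ipL n S (curv n S (f t) (f a) (f a)) (f t) := by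
  rw [scalarCurv]
  refine (contract_frame n S f hf (ricL n S)).trans ?_
  exact Finset.sum_congr rfl fun a _ => ricci_frame n S f hf _ _

lemma cyc {ι : Type*} [Fintype ι] (F : ι → ι → ι → ℝ) :
    ∑ a, ∑ t, ∑ k, F t k a = ∑ a, ∑ t, ∑ k, F a t k := by
  rw [Finset.sum_comm]
  exact Finset.sum_congr rfl fun t _ => by rw [Finset.sum_comm]

/-- Algebraic identity for the total contraction. -/
lemma alg_identity {ι : Type*} [Fintype ι] (c G : ι → ι → ι → ℝ)
    (ha : ∀ a b d, c a b d = - c b a d)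
    (hG : ∀ a b d, G a b d = 2⁻¹ * (c a b d - c b d a + c d a b)) :
    ∑ a, ∑ t, ∑ k, (G a a k * G t k t - G t a k * G a k t - c t a k * G k a t)
      = - ∑ k, (∑ a, c k a a) ^ 2 - 4⁻¹ * ∑ a, ∑ t, ∑ k, c a t k ^ 2
        - 2⁻¹ * ∑ a, ∑ t, ∑ k, c a t k * c a k t := by
  have e1 : ∑ k, (∑ a, c k a a) ^ 2 = ∑ a, ∑ t, ∑ k, c k a a * c k t t := by
    simp only [pow_two, Finset.sum_mul_sum]
    rw [Finset.sum_comm]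
    exact Finset.sum_congr rfl fun t _ => by rw [Finset.sum_comm]
  have e2 : ∑ a, ∑ t, ∑ k, (G a a k * G t k t - G t a k * G a k t - c t a k * G k a t)
      = ∑ a, ∑ t, ∑ k, (- (c k a a * c k t t) - 3/4 * c a t k ^ 2 + 4⁻¹ * c t k a ^ 2
        + 4⁻¹ * c k a t ^ 2 - 2⁻¹ * (c a t k * c a k t)
        - 2⁻¹ * (c t k a * c t a k) + 2⁻¹ * (c k a t * c k t a)) := by
    refine Finset.sum_congr rfl fun a _ => Finset.sum_congr rfl fun t _ =>
      Finset.sum_congr rfl fun k _ => ?_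
    have h0 : c a a k = 0 := by linarith [ha a a k]
    have h1 : c t t k = 0 := by linarith [ha t t k]
    simp only [hG]
    rw [h0, h1, ha a k a, ha t k t, ha t a k, ha k t a, ha a k t]
    ring
  have q1 := cyc (fun a t k => c a t k ^ 2)
  have q2 := cyc (fun a t k => c t k a ^ 2)
  have r1 := cyc (fun a t k => c a t k * c a k t)
  have r2 := cyc (fun a t k => c t k a * c t a k)
  rw [e2, e1]
  simp only [Finset.sum_add_distrib, Finset.sum_sub_distrib, Finset.sum_neg_distrib,
    ← Finset.mul_sum]
  rw [q2, r2, q1, r1]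
  ring

lemma scalar_formula (n : ℕ) (S f) (hf : IsFrame n S f) (hT : Sᵀ = S) (hS : IsUnit S.det) :
    scalarCurv n S = - ∑ k, (∑ a, ipL n S (brL n (f k) (f a)) (f a)) ^ 2
      - 4⁻¹ * ∑ a, ∑ t, ∑ k, ipL n S (brL n (f a) (f t)) (f k) ^ 2
      - 2⁻¹ * ∑ a, ∑ t, ∑ k, ipL n S (brL n (f a) (f t)) (f k)
          * ipL n S (brL n (f a) (f k)) (f t) := by
  have key := alg_identity (fun a b d => ipL n S (brL n (f a) (f b)) (f d))
    (fun a b d => ipL n S (nabL n S (f a) (f b)) (f d))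
    (fun a b d => by
      change _ = - ipL n S (brL n (f b) (f a)) (f d)
      rw [brL_antisymm n (f a) (f b), map_neg, LinearMap.neg_apply])
    (fun a b d => koszul_formula n S hT hS _ _ _)
  refine Eq.trans ?_ key
  rw [scalar_frame n S f hf]
  refine Finset.sum_congr rfl fun a _ => Finset.sum_congr rfl fun t _ => ?_
  have ex : ∀ u w y, ipL n S (nabL n S u w) y
      = ∑ k, ipL n S w (f k) * ipL n S (nabL n S u (f k)) y := by
    intro u w y
    conv_lhs => rw [hf.expand w]
    simp [map_sum, LinearMap.sum_apply]
  have ex' : ∀ u w y, ipL n S (nabL n S u w) y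
      = ∑ k, ipL n S u (f k) * ipL n S (nabL n S (f k) w) y := by
    intro u w y
    conv_lhs => rw [hf.expand u]
    simp [map_sum, LinearMap.sum_apply]
  rw [curv_eq, map_sub, map_sub, LinearMap.sub_apply, LinearMap.sub_apply, ex, ex (f a),
    ex' (brL n (f t) (f a))]
  simp only [Finset.sum_sub_distrib]

lemma structC_zero (n : ℕ) (i j k : Fin (2 * n)) (hk : k.val = 0) : structC n i j k = 0 := by
  have := i.2
  have := j.2
  unfold structC
  repeat rw [if_neg (by rintro ⟨h⟩; simp_all; try omega)]
  simp

lemma structC_off (n : ℕ) (i j k : Fin (2 * n)) (hjk : j ≠ k) (hj : j.val ≠ 0)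
    (hk : k.val ≠ 2 * n - 1) : structC n i j k = 0 := by
  unfold structC
  simp [hjk, hj, hk]

lemma killing_nonneg (n : ℕ) (u : V n) :
    0 ≤ ∑ t, brL n u (brL n u (Pi.single t 1)) t := by
  set M : Fin (2 * n) → Fin (2 * n) → ℝ := fun k j => ∑ i, u i * structC n i j k with hM
  have hbr : ∀ v k, brL n u v k = ∑ j, v j * M k j := by
    intro v k
    simp only [brL_apply, bracket, hM, Finset.mul_sum]
    rw [Finset.sum_comm]
    exact Finset.sum_congr rfl fun i _ => Finset.sum_congr rfl fun j _ => by ring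
  refine Finset.sum_nonneg fun t _ => ?_
  rw [hbr]
  refine Finset.sum_nonneg fun k _ => ?_
  rw [hbr]
  have : ∑ j, (Pi.single t 1 : V n) j * M k j = M k t := by simp [Pi.single_apply]
  rw [this]
  by_cases h : k = t
  · subst h; exact mul_self_nonneg _
  have hz : ∀ k j, k.val = 0 → M k j = 0 := fun k j h0 => by simp [hM, structC_zero n _ j k h0]
  have ho : ∀ k j, j ≠ k → j.val ≠ 0 → k.val ≠ 2 * n - 1 → M k j = 0 := fun k j a b d => by
    simp [hM, structC_off n _ j k a b d]
  by_cases hk0 : k.val = 0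
  · rw [hz k t hk0]; simp
  by_cases ht0 : t.val = 0
  · rw [hz t k ht0]; simp
  by_cases hkl : k.val = 2 * n - 1
  · have : t.val ≠ 2 * n - 1 := fun h' => h (Fin.ext (by omega))
    rw [ho t k h hk0 this]; simp
  · rw [ho k t (Ne.symm h) ht0 hkl]; simp

lemma scalar_neg_of_posDef (n : ℕ) (hn : 2 ≤ n) (S : Matrix (Fin (2 * n)) (Fin (2 * n)) ℝ)
    (hS : S.PosDef) : scalarCurv n S < 0 := by
  obtain ⟨f, hf⟩ := exists_frame n S hS
  have hu : IsUnit S.det := (Matrix.isUnit_iff_isUnit_det _).1 hS.isUnit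
  have hT : Sᵀ = S := by simpa using hS.1.eq
  rw [scalar_formula n S f hf hT hu]
  have h1 : 0 ≤ ∑ k, (∑ a, ipL n S (brL n (f k) (f a)) (f a)) ^ 2 :=
    Finset.sum_nonneg fun _ _ => sq_nonneg _
  have h2 : 0 ≤ ∑ a, ∑ t, ∑ k, ipL n S (brL n (f a) (f t)) (f k)
          * ipL n S (brL n (f a) (f k)) (f t) := by
    refine Finset.sum_nonneg fun a _ => ?_
    have := killing_nonneg n (f a)
    have e := trace_frame n S f hf (brL n (f a) ∘ₗ brL n (f a))
    simp only [LinearMap.comp_apply] at e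
    rw [e] at this
    refine this.trans_eq (Finset.sum_congr rfl fun t _ => ?_)
    conv_lhs => rw [hf.expand (brL n (f a) (f t))]
    simp [map_sum, LinearMap.sum_apply]
  have h3 : 0 < ∑ a, ∑ t, ∑ k, ipL n S (brL n (f a) (f t)) (f k) ^ 2 := by
    by_contra hcon
    have hz : ∀ a t k, ipL n S (brL n (f a) (f t)) (f k) = 0 := by
      intro a t k
      by_contra hne
      apply hcon
      have p0 : 0 < ipL n S (brL n (f a) (f t)) (f k) ^ 2 := by positivity
      refine Finset.sum_pos' (fun _ _ => Finset.sum_nonneg fun _ _ => Finset.sum_nonneg fun _ _ =>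
        sq_nonneg _) ⟨a, Finset.mem_univ _, ?_⟩
      refine Finset.sum_pos' (fun _ _ => Finset.sum_nonneg fun _ _ =>
        sq_nonneg _) ⟨t, Finset.mem_univ _, ?_⟩
      exact Finset.sum_pos' (fun _ _ => sq_nonneg _) ⟨k, Finset.mem_univ _, p0⟩
    have hb : ∀ a t, brL n (f a) (f t) = 0 := by
      intro a t
      rw [hf.expand (brL n (f a) (f t))]
      simp [hz]
    have hb' : ∀ u v, brL n u v = 0 := by
      intro u v
      rw [hf.expand u, hf.expand v]
      simp only [map_sum, map_smul, LinearMap.sum_apply, LinearMap.smul_apply, hb]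
      simp
    have hX := congrFun (hb' (Pi.single ⟨0, by omega⟩ 1) (Pi.single ⟨2 * n - 1, by omega⟩ 1))
      ⟨2 * n - 1, by omega⟩
    have e : brL n (Pi.single ⟨0, by omega⟩ 1) (Pi.single ⟨2 * n - 1, by omega⟩ 1)
      ⟨2 * n - 1, by omega⟩ = structC n ⟨0, by omega⟩ ⟨2 * n - 1, by omega⟩
        ⟨2 * n - 1, by omega⟩ := by
      simp [brL_apply, bracket, Pi.single_apply]
    rw [e] at hX
    have e' : structC n ⟨0, by omega⟩ ⟨2 * n - 1, by omega⟩ ⟨2 * n - 1, by omega⟩ = 1 := by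
      have a1 : ¬ (2 * n - 1 ≤ 2 * n - 2) := by omega
      have a2 : ¬ (2 * n - 1 = 0) := by omega
      have a3 : ¬ (n ≤ 0) := by omega
      simp only [structC, a1, a2, a3]
      simp
    rw [e'] at hX
    simp at hX
  linarith

end CHn

namespace CHn

lemma sum_split (n : ℕ) (hn : 2 ≤ n) (F : Fin (2 * n) → ℝ) :
    ∑ i, F i = F ⟨0, by omega⟩ + ∑ i : Fin (n - 1), F ⟨i.val + 1, by omega⟩
      + ∑ i : Fin (n - 1), F ⟨i.val + n, by omega⟩ + F ⟨2 * n - 1, by omega⟩ := by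
  obtain ⟨m, rfl⟩ : ∃ m, n = m + 1 := ⟨n - 1, by omega⟩
  set g : ℕ → ℝ := fun k => if h : k < 2 * (m + 1) then F ⟨k, h⟩ else 0 with hg
  have hgF : ∀ (k : ℕ) (h : k < 2 * (m + 1)), F ⟨k, h⟩ = g k := fun k h => by simp [hg, h]
  have h1 : ∑ i, F i = ∑ i : Fin (2 * (m + 1)), g i.val :=
    Finset.sum_congr rfl fun i _ => hgF i.val i.2
  rw [h1]
  simp only [hgF]
  rw [← Finset.sum_range (fun i => g i), ← Finset.sum_range (fun i => g (i + 1)),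
    ← Finset.sum_range (fun i => g (i + (m + 1)))]
  have e : 2 * (m + 1) = (m + 1 + m) + 1 := by ring
  have e2 : 2 * (m + 1) - 1 = m + 1 + m := by omega
  rw [e2, e, Finset.sum_range_succ, Finset.sum_range_add, Finset.sum_range_succ']
  simp only [Nat.add_sub_cancel, add_comm (m + 1)]
  ring

section
variable (n : ℕ) (hn : 2 ≤ n) (p β : ℝ) (x σ : Fin (n - 1) → ℝ) (u : V n)

lemma row_X : (Sform n p x σ β *ᵥ u) ⟨0, by omega⟩
    = p * u ⟨0, by omega⟩ + ∑ i : Fin (n - 1), x i * u ⟨i.val + 1, by omega⟩ := by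
  rw [Matrix.mulVec, dotProduct, sum_split n hn]
  have a : ∀ i : Fin (n - 1), i.val + 1 ≤ n - 1 := fun i => by omega
  have b : ∀ i : Fin (n - 1), ¬ (i.val + n ≤ n - 1) := fun i => by omega
  have c : ∀ i : Fin (n - 1), ¬ (i.val + n = 0) := fun i => by omega
  have d : ¬ (2 * n - 1 = 0) := by omega
  have d' : ¬ (2 * n - 1 ≤ n - 1) := by omega
  have d2 : ¬ (0 = 2 * n - 1) := by omega
  have f : n ≠ 0 := by omega
  simp [Sform, a, b, d, d', f, d2]

lemma row_Y (i : Fin (n - 1)) : (Sform n p x σ β *ᵥ u) ⟨i.val + 1, by omega⟩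
    = x i * u ⟨0, by omega⟩ + σ i * u ⟨i.val + 1, by omega⟩ := by
  rw [Matrix.mulVec, dotProduct, sum_split n hn]
  have a : i.val + 1 ≤ n - 1 := by omega
  have b : ∀ j : Fin (n - 1), ¬ (i.val + 1 = j.val + n) := fun j => by omega
  have d : ¬ (i.val + 1 = 2 * n - 1) := by omega
  have d' : ¬ (n ≤ i.val + 1) := by omega
  have e : ∀ j : Fin (n - 1), i.val = j.val ↔ i = j := fun j => Fin.ext_iff.symm
  have d1 : ¬ (2 * n - 1 = 0) := by omega
  have f : n ≠ 0 := by omega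
  simp [Sform, a, b, d, d', e, f, d1]

lemma row_Z (i : Fin (n - 1)) : (Sform n p x σ β *ᵥ u) ⟨i.val + n, by omega⟩
    = σ i * u ⟨i.val + n, by omega⟩ := by
  rw [Matrix.mulVec, dotProduct, sum_split n hn]
  have a : ¬ (i.val + n ≤ n - 1) := by omega
  have b : ∀ j : Fin (n - 1), ¬ (i.val + n = j.val + 1) := fun j => by omega
  have c : i.val + n ≤ 2 * n - 2 := by omega
  have d : ¬ (i.val + n = 2 * n - 1) := by omega
  have e : ∀ j : Fin (n - 1), i.val = j.val ↔ i = j := fun j => Fin.ext_iff.symm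
  have d1 : ¬ (2 * n - 1 = 0) := by omega
  have f : n ≠ 0 := by omega
  simp [Sform, a, b, c, d, e, f, d1]

lemma row_W : (Sform n p x σ β *ᵥ u) ⟨2 * n - 1, by omega⟩ = β * u ⟨2 * n - 1, by omega⟩ := by
  rw [Matrix.mulVec, dotProduct, sum_split n hn]
  have a : ¬ (2 * n - 1 ≤ n - 1) := by omega
  have b : ∀ j : Fin (n - 1), ¬ (2 * n - 1 = j.val + 1) := fun j => by omega
  have b' : ∀ j : Fin (n - 1), ¬ (2 * n - 1 = j.val + n) := fun j => by omega
  have c : ¬ (2 * n - 1 ≤ 2 * n - 2) := by omega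
  have d1 : ¬ (2 * n - 1 = 0) := by omega
  have f : n ≠ 0 := by omega
  simp [Sform, a, b, b', c, f, d1]

lemma Sform_symm (i j : Fin (2 * n)) : Sform n p x σ β j i = Sform n p x σ β i j := by
  by_cases h : i = j
  · rw [h]
  · have h' : ¬ j = i := fun e => h e.symm
    have := i.2
    have := j.2
    have hv : i.val ≠ j.val := fun e => h (Fin.ext e)
    unfold Sform
    simp only [h, h', false_and]
    split_ifs <;> first | rfl | (exfalso; omega)

end

lemma Sform_posDef (n : ℕ) (hn : 2 ≤ n) (p β : ℝ) (x σ : Fin (n - 1) → ℝ)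
    (hβ : 0 < β) (hσ : ∀ i, 0 < σ i) (hz : 0 < zval n p x σ) :
    (Sform n p x σ β).PosDef := by
  refine Matrix.PosDef.of_dotProduct_mulVec_pos ?_ ?_
  · ext i j; simp [Matrix.conjTranspose_apply, Sform_symm n p β x σ i j]
  intro u hu
  set X := u ⟨0, by omega⟩ with hX
  set Y : Fin (n - 1) → ℝ := fun i => u ⟨i.val + 1, by omega⟩ with hY
  set Z : Fin (n - 1) → ℝ := fun i => u ⟨i.val + n, by omega⟩ with hZ
  set W := u ⟨2 * n - 1, by omega⟩ with hW
  have key : star u ⬝ᵥ (Sform n p x σ β *ᵥ u) = zval n p x σ * X ^ 2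
      + ∑ i, σ i * (Y i + x i / σ i * X) ^ 2 + ∑ i, σ i * Z i ^ 2 + β * W ^ 2 := by
    rw [star_trivial, dotProduct, sum_split n hn]
    simp only [row_X n hn, row_Y n hn, row_Z n hn, row_W n hn]
    have e1 : ∑ i, σ i * (Y i + x i / σ i * X) ^ 2
        = ∑ i, Y i * (x i * X + σ i * Y i) + X * ∑ i, x i * Y i
          + (∑ i, x i ^ 2 / σ i) * X ^ 2 := by
      rw [Finset.mul_sum, Finset.sum_mul, ← Finset.sum_add_distrib, ← Finset.sum_add_distrib]
      refine Finset.sum_congr rfl fun i _ => ?_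
      have := (hσ i).ne'
      field_simp
      ring
    have e2 : ∑ i, σ i * Z i ^ 2 = ∑ i, Z i * (σ i * Z i) :=
      Finset.sum_congr rfl fun i _ => by ring
    rw [e1, e2, zval]
    ring
  rw [key]
  have n1 : 0 ≤ zval n p x σ * X ^ 2 := by positivity
  have n2' : ∀ i, 0 ≤ σ i * (Y i + x i / σ i * X) ^ 2 := fun i =>
    mul_nonneg (hσ i).le (sq_nonneg _)
  have n3' : ∀ i, 0 ≤ σ i * Z i ^ 2 := fun i => mul_nonneg (hσ i).le (sq_nonneg _)
  have n2 := Finset.sum_nonneg fun i (_ : i ∈ Finset.univ) => n2' i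
  have n3 := Finset.sum_nonneg fun i (_ : i ∈ Finset.univ) => n3' i
  have n4 : 0 ≤ β * W ^ 2 := by positivity
  by_contra hcon
  apply hu
  have z1 : zval n p x σ * X ^ 2 = 0 := by linarith
  have z2 : ∑ i, σ i * (Y i + x i / σ i * X) ^ 2 = 0 := by linarith
  have z3 : ∑ i, σ i * Z i ^ 2 = 0 := by linarith
  have z4 : β * W ^ 2 = 0 := by linarith
  have X0 : X = 0 := by simpa [hz.ne'] using z1
  have W0 : W = 0 := by simpa [hβ.ne'] using z4
  have Y0 : ∀ i, Y i = 0 := fun i => by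
    have := (Finset.sum_eq_zero_iff_of_nonneg fun i _ => n2' i).1 z2 i (Finset.mem_univ _)
    simpa [(hσ i).ne', X0] using this
  have Z0 : ∀ i, Z i = 0 := fun i => by
    have := (Finset.sum_eq_zero_iff_of_nonneg fun i _ => n3' i).1 z3 i (Finset.mem_univ _)
    simpa [(hσ i).ne'] using this
  ext k
  have hk := k.2
  rw [Pi.zero_apply]
  by_cases k0 : k.val = 0
  · rw [← X0, hX]; congr 1; exact Fin.ext k0
  by_cases k1 : k.val ≤ n - 1
  · rw [← Y0 ⟨k.val - 1, by omega⟩]; simp only [hY]; congr 1; apply Fin.ext; simp only; omega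
  by_cases k2 : k.val ≤ 2 * n - 2
  · rw [← Z0 ⟨k.val - n, by omega⟩]; simp only [hZ]; congr 1; apply Fin.ext; simp only; omega
  · rw [← W0, hW]; congr 1; apply Fin.ext; simp only; omega

end CHn

namespace CHn

/-- Every left invariant Riemannian metric on `CH(n)` has (constant) negative
scalar curvature. -/
theorem scalar_curvature_neg (n : ℕ) (hn : 2 ≤ n) (p β : ℝ)
    (x σ : Fin (n - 1) → ℝ)
    (hadm : Admissible n p x σ β) (hz : 0 < zval n p x σ) :
    scalarCurv n (Sform n p x σ β) < 0 := by
  obtain ⟨_, hβ, _, _, hσ, _⟩ := hadm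
  exact scalar_neg_of_posDef n hn _
    (Sform_posDef n hn p β x σ hβ (fun i => lt_of_lt_of_le one_pos (hσ i)) hz)

end CHn
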